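/- Let G = (V, E) be a finite graph with |V| = n and a fixed orientation (u_e, v_e) of each edge e ∈ E, and let k be a natural number. Let F'(G) be the Boolean formula over the variables {x_v : v ∈ V} ∪ {y_e : e ∈ E} ∪ {z_e : e ∈ E} consisting, for each edge e ∈ E, of the two clauses (y_e ∨ ¬z_e ∨ ¬x_{u_e}) and (¬y_e ∨ z_e ∨ ¬x_{v_e}). Let s be the assignment setting all variables to 1 and t the assignment setting x_v = 1 for all v ∈ V and y_e = z_e = 0 for all e ∈ E; both s and t satisfy F'(G). Then G has an independent set of size at least k if and only if there exists a valid flip sequence from s to t of length at most 2|E| + 2(n − k). -/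

import Mathlib

/-- A flip is a variable together with the value it flips *to*:
`(i, true)` is the positive flip `xᵢ⁺` (0→1), `(i, false)` the negative flip `xᵢ⁻` (1→0). -/
abbrev Flip (α : Type) := α × Bool

/-- Apply a flip to an assignment. -/
def applyFlip {α : Type} [DecidableEq α] (a : α → Bool) (f : Flip α) : α → Bool :=
  Function.update a f.1 f.2

/-- Apply a flip sequence (left to right) to an assignment; `applySeq s F` is `F(s)`. -/
def applySeq {α : Type} [DecidableEq α] (s : α → Bool) (F : List (Flip α)) : α → Bool :=
  F.foldl applyFlip s

/-- `ValidSeq R s F`: the flip sequence `F` is valid at `s` with respect to `R`, i.e.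
each flip in turn is applicable and every intermediate assignment (including `s` and
the final one) lies in `R`. -/
def ValidSeq {α : Type} [DecidableEq α] (R : Set (α → Bool)) :
    (α → Bool) → List (Flip α) → Prop
  | s, [] => s ∈ R
  | s, f :: F => s ∈ R ∧ s f.1 = !f.2 ∧ ValidSeq R (applyFlip s f) F

/-- The satisfying assignments of the formula `F'(G)`: for each edge `e = (u_e, v_e)` the
clauses `(y_e ∨ ¬z_e ∨ ¬x_{u_e})` and `(¬y_e ∨ z_e ∨ ¬x_{v_e})`, over the variables
`x_w (w ∈ V)`, `y_e, z_e (e ∈ E)` encoded as `V ⊕ E ⊕ E`. -/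
def indepSat {V E : Type} (u v : E → V) (a : (V ⊕ E ⊕ E) → Bool) : Prop :=
  ∀ e : E,
    (a (.inr (.inl e)) = true ∨ a (.inr (.inr e)) = false ∨ a (.inl (u e)) = false) ∧
    (a (.inr (.inr e)) = true ∨ a (.inr (.inl e)) = false ∨ a (.inl (v e)) = false)

/-- `FlipReach R s t m`: some flip sequence of length `m` valid within `R` leads from `s` to `t`. -/
def FlipReach {α : Type} [DecidableEq α] (R : Set (α → Bool)) (s t : α → Bool) (m : ℕ) : Prop :=
  ∃ F : List (Flip α), ValidSeq R s F ∧ applySeq s F = t ∧ F.length = m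

/-- The number of times the variable `i` is flipped in `F`. -/
def flipCount {α : Type} [DecidableEq α] (F : List (Flip α)) (i : α) : ℕ :=
  (F.map Prod.fst).count i

section General

variable {α : Type} [DecidableEq α] {R : Set (α → Bool)}

lemma ValidSeq.mem {s : α → Bool} {F : List (Flip α)} (h : ValidSeq R s F) : s ∈ R := by
  cases F with
  | nil => exact h
  | cons f F => exact h.1

lemma ValidSeq.append {F G : List (Flip α)} {s : α → Bool} (hF : ValidSeq R s F)
    (hG : ValidSeq R (applySeq s F) G) : ValidSeq R s (F ++ G) := by
  induction F generalizing s with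
  | nil => exact hG
  | cons f F ih => exact ⟨hF.1, hF.2.1, ih hF.2.2 hG⟩

lemma FlipReach.refl {s : α → Bool} (hs : s ∈ R) : FlipReach R s s 0 :=
  ⟨[], hs, rfl, rfl⟩

lemma FlipReach.trans {s t r : α → Bool} {m n : ℕ} (h₁ : FlipReach R s t m)
    (h₂ : FlipReach R t r n) : FlipReach R s r (m + n) := by
  obtain ⟨F, hF, rfl, rfl⟩ := h₁
  obtain ⟨G, hG, rfl, rfl⟩ := h₂
  exact ⟨F ++ G, hF.append hG, List.foldl_append, List.length_append⟩

lemma FlipReach.update {s : α → Bool} {i : α} {b : Bool} (hs : s ∈ R)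
    (ht : Function.update s i b ∈ R) (hi : s i = !b) :
    FlipReach R s (Function.update s i b) 1 :=
  ⟨[(i, b)], ⟨hs, hi, ht⟩, rfl, rfl⟩

/-- Along a valid sequence a variable changes its value iff it is flipped an odd number of times. -/
lemma ValidSeq.applySeq_apply {F : List (Flip α)} {s : α → Bool} (h : ValidSeq R s F) (i : α) :
    applySeq s F i = (s i ^^ decide (Odd (flipCount F i))) := by
  induction F generalizing s with
  | nil => simp [applySeq, flipCount]
  | cons f F ih =>
    have h₁ := ih h.2.2
    have h₂ := h.2.1
    change applySeq (applyFlip s f) F i = _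
    rw [h₁, flipCount, flipCount, List.map_cons, List.count_cons]
    by_cases hi : i = f.1
    · subst hi
      by_cases ho : Odd ((F.map Prod.fst).count f.1) <;>
        simp [applyFlip, h₂, Nat.odd_add_one, ho]
    · simp [applyFlip, hi, Ne.symm hi]

lemma flipCount_eq_zero {F : List (Flip α)} {i : α} :
    flipCount F i = 0 ↔ i ∉ F.map Prod.fst :=
  List.count_eq_zero

lemma sum_flipCount [Fintype α] (F : List (Flip α)) : ∑ i, flipCount F i = F.length := by
  simpa [flipCount] using Multiset.sum_count_eq_card (s := Finset.univ)
    (m := (F.map Prod.fst : Multiset α)) (by simp)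

end General

section Formula

variable {V E : Type} [DecidableEq V] [DecidableEq E] {u v : E → V}

/-- If neither endpoint variable of `e` is ever flipped away from `1`, then `y_e` is never
flipped. -/
lemma ValidSeq.y_notMem {F : List (Flip (V ⊕ E ⊕ E))} {s : V ⊕ E ⊕ E → Bool} {e : E}
    (h : ValidSeq {a | indepSat u v a} s F) (hu : s (.inl (u e)) = true)
    (hv : s (.inl (v e)) = true) (hu' : .inl (u e) ∉ F.map Prod.fst)
    (hv' : .inl (v e) ∉ F.map Prod.fst) : .inr (.inl e) ∉ F.map Prod.fst := by
  induction F generalizing s with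
  | nil => simp
  | cons f F ih =>
    obtain ⟨i, b⟩ := f
    simp only [List.map_cons, List.mem_cons, not_or] at hu' hv' ⊢
    obtain ⟨h₀, h₁, h₂⟩ := h
    have hu₁ : applyFlip s (i, b) (.inl (u e)) = true := by simp [applyFlip, hu'.1, hu]
    have hv₁ : applyFlip s (i, b) (.inl (v e)) = true := by simp [applyFlip, hv'.1, hv]
    refine ⟨?_, ih h₂ hu₁ hv₁ hu'.2 hv'.2⟩
    rintro rfl
    have h₃ := h₀ e
    have h₄ := h₂.mem e
    rw [hu₁, hv₁] at h₄
    rw [hu, hv] at h₃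
    simp only [applyFlip] at h₁ h₄
    cases b <;> simp_all

/-- The assignment that is `0` exactly at `x_w` for `w ∈ C` and at `y_e`, `z_e` for `e ∈ D`. -/
def zeroOn (C : Finset V) (D : Finset E) : V ⊕ E ⊕ E → Bool :=
  Sum.elim (fun w => decide (w ∉ C))
    (Sum.elim (fun e => decide (e ∉ D)) (fun e => decide (e ∉ D)))

lemma indepSat_zeroOn (C : Finset V) (D : Finset E) : indepSat u v (zeroOn C D) := by
  intro e
  by_cases he : e ∈ D <;> simp [zeroOn, he]

lemma update_zeroOn_insert {C : Finset V} {w : V} (hw : w ∉ C) (D : Finset E) :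
    Function.update (zeroOn (insert w C) D) (.inl w) true = zeroOn C D := by
  ext (x | e | e)
  · by_cases hx : x = w <;> simp [zeroOn, hx, hw]
  · simp [zeroOn]
  · simp [zeroOn]

lemma update_zeroOn {C : Finset V} (w : V) (D : Finset E) :
    Function.update (zeroOn C D) (.inl w) false = zeroOn (insert w C) D := by
  ext (x | e | e)
  · by_cases hx : x = w <;> simp [zeroOn, hx]
  · simp [zeroOn]
  · simp [zeroOn]

lemma flipReach_zeroOn_vertices (C : Finset V) (D : Finset E) :
    FlipReach {a | indepSat u v a} (zeroOn ∅ D) (zeroOn C D) C.card := by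
  induction C using Finset.induction_on with
  | empty => exact .refl (indepSat_zeroOn _ _)
  | insert w C hw ih =>
    rw [Finset.card_insert_of_notMem hw, ← update_zeroOn]
    refine ih.trans (.update (indepSat_zeroOn _ _) ?_ (by simp [zeroOn, hw]))
    rw [update_zeroOn]
    exact indepSat_zeroOn _ _

lemma flipReach_vertices_zeroOn (C : Finset V) (D : Finset E) :
    FlipReach {a | indepSat u v a} (zeroOn C D) (zeroOn ∅ D) C.card := by
  induction C using Finset.induction_on with
  | empty => exact .refl (indepSat_zeroOn _ _)
  | insert w C hw ih =>
    have hstep := update_zeroOn_insert hw D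
    rw [Finset.card_insert_of_notMem hw, add_comm]
    refine FlipReach.trans ?_ ih
    rw [← hstep]
    refine .update (indepSat_zeroOn _ _) ?_ (by simp [zeroOn])
    rw [hstep]
    exact indepSat_zeroOn _ _

lemma update_update_zeroOn (C : Finset V) (D : Finset E) (e : E) :
    Function.update (Function.update (zeroOn C D) (.inr (.inl e)) false) (.inr (.inr e)) false =
      zeroOn C (insert e D) := by
  ext (x | e' | e')
  · simp only [Function.update_apply]; simp [zeroOn]
  · by_cases hx : e' = e <;> simp only [Function.update_apply] <;> simp [zeroOn, hx]
  · by_cases hx : e' = e <;> simp only [Function.update_apply] <;> simp [zeroOn, hx]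

lemma flipReach_zeroOn_insert_edge {C : Finset V} {D : Finset E} {e : E}
    (hC : u e ∈ C ∨ v e ∈ C) (he : e ∉ D) :
    FlipReach {a | indepSat u v a} (zeroOn C D) (zeroOn C (insert e D)) 2 := by
  have hend : indepSat u v (zeroOn C (insert e D)) := indepSat_zeroOn _ _
  have hstep := update_update_zeroOn C D e
  rcases hC with hC | hC
  · have hmid : indepSat u v (Function.update (zeroOn C D) (.inr (.inl e)) false) := by
      intro e'
      by_cases h : e' = e
      · subst h; simp [zeroOn, hC, he]
      · by_cases h' : e' ∈ D <;> simp [zeroOn, h, h']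
    rw [← hstep] at hend ⊢
    exact (FlipReach.update (indepSat_zeroOn _ _) hmid (by simp [zeroOn, he])).trans
      (.update hmid hend (by simp [zeroOn, he]))
  · have hmid : indepSat u v (Function.update (zeroOn C D) (.inr (.inr e)) false) := by
      intro e'
      by_cases h : e' = e
      · subst h; simp [zeroOn, hC, he]
      · by_cases h' : e' ∈ D <;> simp [zeroOn, h, h']
    rw [← hstep, Function.update_comm (by simp)] at hend ⊢
    exact (FlipReach.update (indepSat_zeroOn _ _) hmid (by simp [zeroOn, he])).trans
      (.update hmid hend (by simp [zeroOn, he]))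

lemma flipReach_zeroOn_edges {C : Finset V} (hC : ∀ e, u e ∈ C ∨ v e ∈ C) (D : Finset E) :
    FlipReach {a | indepSat u v a} (zeroOn C ∅) (zeroOn C D) (2 * D.card) := by
  induction D using Finset.induction_on with
  | empty => exact .refl (indepSat_zeroOn _ _)
  | insert e D he ih =>
    rw [Finset.card_insert_of_notMem he, mul_add]
    exact ih.trans (flipReach_zeroOn_insert_edge (hC e) he)

end Formula

/-- For a finite graph `G` with `n` vertices and oriented edges `e = (u e, v e)`, with
`s` the all-one assignment and `t` the assignment setting exactly the `y_e` and `z_e`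
variables to `0`: `s` and `t` satisfy `F'(G)`, and `G` has an independent set of size at
least `k` iff there is a valid flip sequence from `s` to `t` of length at most
`2|E| + 2(n − k)`. -/
theorem independentSet_iff_short_flipSeq (V E : Type) [Fintype V] [Fintype E]
    [DecidableEq V] [DecidableEq E] (u v : E → V) (hloopless : ∀ e : E, u e ≠ v e)
    (k : ℕ) :
    indepSat u v (fun _ => true) ∧
    indepSat u v (Sum.elim (fun _ => true) (fun _ => false)) ∧
    ((∃ I : Finset V, (∀ e : E, ¬(u e ∈ I ∧ v e ∈ I)) ∧ k ≤ I.card) ↔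
      ∃ F : List (Flip (V ⊕ E ⊕ E)),
        ValidSeq {a | indepSat u v a} (fun _ => true) F ∧
        applySeq (fun _ => true) F = Sum.elim (fun _ => true) (fun _ => false) ∧
        (F.length : ℤ) ≤ 2 * Fintype.card E + 2 * ((Fintype.card V : ℤ) - k)) := by
  refine ⟨by simp [indepSat], by simp [indepSat], ?_, ?_⟩
  · rintro ⟨I, hI, hk⟩
    have hcover : ∀ e, u e ∈ Iᶜ ∨ v e ∈ Iᶜ := by
      intro e
      have := hI e
      simp only [Finset.mem_compl]
      tauto
    obtain ⟨F, hF, hFt, hlen⟩ := ((flipReach_zeroOn_vertices (u := u) (v := v) Iᶜ ∅).trans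
      (flipReach_zeroOn_edges hcover Finset.univ)).trans
      (flipReach_vertices_zeroOn Iᶜ Finset.univ)
    have hs : (zeroOn ∅ ∅ : V ⊕ E ⊕ E → Bool) = fun _ => true := by
      ext (x | e | e) <;> simp [zeroOn]
    have ht : (zeroOn ∅ Finset.univ : V ⊕ E ⊕ E → Bool) =
        Sum.elim (fun _ => true) (fun _ => false) := by
      ext (x | e | e) <;> simp [zeroOn]
    rw [hs] at hF hFt
    rw [ht] at hFt
    refine ⟨F, hF, hFt, ?_⟩
    have hcard := I.card_add_card_compl
    rw [Finset.card_univ] at hlen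
    omega
  · rintro ⟨F, hF, hFt, hlen⟩
    have hparity (i) : applySeq (fun _ => true) F i = (true ^^ decide (Odd (flipCount F i))) :=
      hF.applySeq_apply i
    rw [hFt] at hparity
    let C : Finset V := {w | flipCount F (.inl w) ≠ 0}
    refine ⟨Cᶜ, ?_, ?_⟩
    · rintro e ⟨hu, hv⟩
      simp only [C, Finset.mem_compl, Finset.mem_filter, Finset.mem_univ, true_and, not_not,
        flipCount_eq_zero] at hu hv
      have hy : flipCount F (.inr (.inl e)) = 0 := flipCount_eq_zero.2 (hF.y_notMem rfl rfl hu hv)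
      have := hparity (.inr (.inl e))
      simp [hy] at this
    · have hsum := sum_flipCount F
      rw [Fintype.sum_sum_type, Fintype.sum_sum_type] at hsum
      have hedge (i : E ⊕ E) : 1 ≤ flipCount F (.inr i) := by
        have := hparity (.inr i)
        simp only [Sum.elim_inr, Bool.true_xor, Bool.false_eq, Bool.not_eq_false',
          decide_eq_true_eq] at this
        exact this.pos
      have hy : Fintype.card E ≤ ∑ e : E, flipCount F (.inr (.inl e)) := by
        simpa using Finset.sum_le_sum fun e (_ : e ∈ Finset.univ) => hedge (.inl e)
      have hz : Fintype.card E ≤ ∑ e : E, flipCount F (.inr (.inr e)) := by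
        simpa using Finset.sum_le_sum fun e (_ : e ∈ Finset.univ) => hedge (.inr e)
      have hx : 2 * C.card ≤ ∑ w : V, flipCount F (.inl w) := by
        rw [mul_comm, ← smul_eq_mul]
        refine (Finset.card_nsmul_le_sum C _ 2 fun w hw => ?_).trans
          (Finset.sum_le_univ_sum_of_nonneg fun _ => Nat.zero_le _)
        have h₀ : flipCount F (.inl w) ≠ 0 := by simpa [C] using hw
        have h₁ := hparity (.inl w)
        have h₂ : Even (flipCount F (.inl w)) := by simpa using h₁
        obtain ⟨r, hr⟩ := h₂
        omega
      have hcard := C.card_add_card_compl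
      omega
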